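/- arXiv:2310.20382 — 2 statements merged into one kernel-verified Lean document; each statement's English description precedes it below -/
import Mathlib

section
/- Blow-up for the focusing discrete nonlinear Klein–Gordon equation with negative energy: Let d ≥ 1, h > 0, σ > 0, λ = −1, and let V = {V_n} ∈ l^∞_h be a real-valued potential with inf_{n∈hℤ^d} V_n > 0. Let (f,g) ∈ l²_h × l²_h be real-valued with E(f,g) < 0, where E(u,v) = ½ Σ_{n∈hℤ^d} ( v_n² + h^{-2} Σ_{j=1}^d (u_{n+he_j} − u_n)² + V_n u_n² − (σ+1)^{-1} |u_n|^{2σ+2} ). Then there is no twice continuously differentiable map u : [0,∞) → l²_h (real-valued sequences) with u(0) = f, ∂_t u(0) = g satisfying ∂_t² u_n(t) − (Δ_h u(t))_n + V_n u_n(t) − |u_n(t)|^{2σ} u_n(t) = 0 for all t ≥ 0 and n ∈ hℤ^d; i.e., the maximal time of existence T_* of the solution with data (f,g) is finite. -/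
noncomputable section

open scoped ENNReal

/-- The integer lattice indexing `hℤ^d` (the point `n ∈ hℤ^d` corresponds to `h • n`). -/
abbrev ZLat (d : ℕ) := Fin d → ℤ

/-- The `j`-th standard basis vector of the lattice. -/
def latE {d : ℕ} (j : Fin d) : ZLat d := Pi.single j 1

/-- The discrete Laplacian `Δ_h` on real-valued sequences on `hℤ^d`, acting pointwise:
`(Δ_h u)_n = h⁻² Σ_j (u_{n+he_j} + u_{n−he_j} − 2u_n)`. -/
def discLapR (d : ℕ) (h : ℝ) (u : ZLat d → ℝ) : ZLat d → ℝ :=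
  fun n => (∑ j : Fin d, (u (n + latE j) + u (n - latE j) - 2 * u n)) / h ^ 2

/-- `u : ℝ → l^p_h` (real-valued) is a twice continuously differentiable solution
(with first and second derivatives `u'`, `u''`) of the discrete nonlinear Klein–Gordon equation
`∂_t² u_n(t) − (Δ_h u(t))_n + V_n u_n(t) + λ |u_n(t)|^{2σ} u_n(t) = 0` on the set `S ⊆ ℝ`. -/
def IsDKGSolutionOn (d : ℕ) (h σ lam : ℝ) (V : ZLat d → ℝ) (p : ℝ≥0∞) [Fact (1 ≤ p)]
    (S : Set ℝ) (u u' u'' : ℝ → lp (fun _ : ZLat d => ℝ) p) : Prop :=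
  (∀ t ∈ S, HasDerivWithinAt u (u' t) S t) ∧
  (∀ t ∈ S, HasDerivWithinAt u' (u'' t) S t) ∧
  ContinuousOn u'' S ∧
    ∀ t ∈ S, ∀ n : ZLat d,
      (u'' t : ZLat d → ℝ) n - discLapR d h (⇑(u t)) n + V n * (u t : ZLat d → ℝ) n
        + lam * |(u t : ZLat d → ℝ) n| ^ (2 * σ) * (u t : ZLat d → ℝ) n = 0

/-- The conserved energy of the discrete nonlinear Klein–Gordon equation:
`E(u,v) = ½ Σ_n ( v_n² + h⁻² Σ_j (u_{n+he_j} − u_n)² + V_n u_n² + (λ/(σ+1)) |u_n|^{2σ+2} )`. -/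
def energyKG (d : ℕ) (h σ lam : ℝ) (V : ZLat d → ℝ) (u v : ZLat d → ℝ) : ℝ :=
  (1 / 2) * ∑' n : ZLat d,
    (v n ^ 2 + (∑ j : Fin d, (u (n + latE j) - u n) ^ 2) / h ^ 2 + V n * u n ^ 2
      + (lam / (σ + 1)) * |u n| ^ (2 * σ + 2))

section Helpers
open Set Filter Topology Asymptotics

lemma kg_dcongr {f g : ℝ → ℝ} {f' g' t : ℝ} {s : Set ℝ} (hf : HasDerivWithinAt f f' s t)
    (h : ∀ x, g x = f x) (h' : g' = f') : HasDerivWithinAt g g' s t := by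
  obtain rfl : g = f := funext h
  subst h'
  exact hf

lemma kg_scongr {α : Type*} {f g : α → ℝ} {a b : ℝ} (hf : HasSum f a)
    (h : ∀ x, g x = f x) (h' : b = a) : HasSum g b := by
  obtain rfl : g = f := funext h
  subst h'
  exact hf

lemma kg_ode (y y1 y2 : ℝ → ℝ) (k ε : ℝ) (hk : 0 < k) (hε : 0 < ε)
    (h0 : ∀ t ∈ Ici (0:ℝ), HasDerivWithinAt y (y1 t) (Ici 0) t)
    (h1 : ∀ t ∈ Ici (0:ℝ), HasDerivWithinAt y1 (y2 t) (Ici 0) t)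
    (hy : ∀ t ∈ Ici (0:ℝ), 0 ≤ y t)
    (h2 : ∀ t ∈ Ici (0:ℝ), k ≤ y2 t)
    (h3 : ∀ t ∈ Ici (0:ℝ), (1 + ε) * y1 t ^ 2 ≤ y t * y2 t) : False := by
  have hm : MonotoneOn (fun t => y1 t - k * t) (Ici 0) := by
    apply monotoneOn_of_hasDerivWithinAt_nonneg (f' := fun t => y2 t - k) (convex_Ici 0)
    · intro t ht
      exact ((h1 t ht).continuousWithinAt).sub (by fun_prop)
    · intro t ht
      rw [interior_Ici] at ht ⊢
      have := ((h1 t (Ioi_subset_Ici_self ht)).mono Ioi_subset_Ici_self).sub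
        (((hasDerivAt_id t).const_mul k).hasDerivWithinAt (s := Ioi 0))
      exact kg_dcongr this (fun x => by simp) (by simp)
    · intro t ht
      rw [interior_Ici] at ht
      have := h2 t (Ioi_subset_Ici_self ht)
      linarith
  obtain ⟨t0, ht0, hpos⟩ : ∃ t0 : ℝ, 0 ≤ t0 ∧ ∀ t, t0 ≤ t → 0 < y1 t := by
    refine ⟨(|y1 0| + 1) / k, by positivity, fun t ht => ?_⟩
    have htn : 0 ≤ t := le_trans (by positivity) ht
    have := hm (mem_Ici.2 le_rfl) (mem_Ici.2 htn) htn
    rw [div_le_iff₀ hk] at ht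
    have := neg_abs_le (y1 0)
    simp only at *
    linarith
  have hsub : Ici t0 ⊆ Ici (0:ℝ) := Ici_subset_Ici.2 ht0
  have ha : AntitoneOn (fun t => y t / y1 t + ε * t) (Ici t0) := by
    apply antitoneOn_of_hasDerivWithinAt_nonpos
      (f' := fun t => (y1 t * y1 t - y t * y2 t) / y1 t ^ 2 + ε) (convex_Ici t0)
    · intro t ht
      exact (((h0 t (hsub ht)).continuousWithinAt.mono hsub).div
        ((h1 t (hsub ht)).continuousWithinAt.mono hsub) (hpos t ht).ne').add (by fun_prop)
    · intro t ht
      rw [interior_Ici] at ht ⊢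
      have hs : Ioi t0 ⊆ Ici (0:ℝ) := Ioi_subset_Ici_self.trans hsub
      have := (((h0 t (hs ht)).mono hs).div ((h1 t (hs ht)).mono hs) (hpos t ht.le).ne').add
        (((hasDerivAt_id t).const_mul ε).hasDerivWithinAt (s := Ioi t0))
      exact kg_dcongr this (fun x => by simp) (by simp)
    · intro t ht
      rw [interior_Ici] at ht
      have hp := hpos t ht.le
      have := h3 t (hsub (mem_Ici.2 (le_of_lt ht)))
      have : (y1 t * y1 t - y t * y2 t) / y1 t ^ 2 ≤ -ε := by
        rw [div_le_iff₀ (by positivity)]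
        nlinarith
      linarith
  have hv : ∀ t, t0 ≤ t → 0 ≤ y t / y1 t := fun t ht =>
    div_nonneg (hy t (hsub ht)) (hpos t ht).le
  have hT : t0 ≤ t0 + (y t0 / y1 t0 + 1) / ε := by
    have := hv t0 le_rfl
    have : 0 ≤ (y t0 / y1 t0 + 1) / ε := by positivity
    linarith
  have h4 := ha (mem_Ici.2 le_rfl) (mem_Ici.2 hT) hT
  have h5 := hv _ hT
  have h6 : ε * (t0 + (y t0 / y1 t0 + 1) / ε) = ε * t0 + (y t0 / y1 t0 + 1) := by
    field_simp
  simp only [h6] at h4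
  linarith

lemma kg_abstract {H : Type*} [NormedAddCommGroup H] [InnerProductSpace ℝ H]
    (A : H →L[ℝ] H) (hA : ∀ x y, inner ℝ (A x) y = inner ℝ x (A y))
    (hApos : ∀ x, 0 ≤ inner ℝ (A x) x) (σ : ℝ) (hσ : 0 < σ)
    (u u' u'' N : ℝ → H)
    (h0 : ∀ t ∈ Ici (0:ℝ), HasDerivWithinAt u (u' t) (Ici 0) t)
    (h1 : ∀ t ∈ Ici (0:ℝ), HasDerivWithinAt u' (u'' t) (Ici 0) t)
    (h2 : ContinuousOn u'' (Ici 0))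
    (hN : ∀ t, N t = u'' t + A (u t))
    (hconv : ∀ s ∈ Ici (0:ℝ), ∀ t ∈ Ici (0:ℝ), (2 * σ + 2) * inner ℝ (N t) (u s - u t) ≤
      inner ℝ (u s) (N s) - inner ℝ (u t) (N t))
    (hE : ‖u' 0‖ ^ 2 + inner ℝ (A (u 0)) (u 0) - inner ℝ (u 0) (N 0) / (σ + 1) < 0) : False := by
  have hσ1 : (0:ℝ) < σ + 1 := by linarith
  have hNc : ContinuousOn N (Ici 0) := by
    have : N = fun t => u'' t + A (u t) := funext hN
    rw [this]
    exact h2.add (A.continuous.comp_continuousOn fun t ht => (h0 t ht).continuousWithinAt)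
  have hP : ∀ t ∈ Ici (0:ℝ), HasDerivWithinAt (fun s => inner ℝ (u s) (N s))
      ((2 * σ + 2) * inner ℝ (N t) (u' t)) (Ici 0) t := by
    intro t ht
    have hlin : HasDerivWithinAt (fun s => (2 * σ + 2) * inner ℝ (N t) (u s))
        ((2 * σ + 2) * inner ℝ (N t) (u' t)) (Ici 0) t := by
      have := ((hasDerivWithinAt_const t (Ici 0) (N t)).inner ℝ (h0 t ht)).const_mul (2 * σ + 2)
      simpa using this
    have hrem : HasDerivWithinAt
        (fun s => inner ℝ (u s) (N s) - (2 * σ + 2) * inner ℝ (N t) (u s)) 0 (Ici 0) t := by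
      rw [hasDerivWithinAt_iff_isLittleO]
      have hb : (fun s => (2 * σ + 2) * (‖N s - N t‖ * ‖u s - u t‖)) =o[𝓝[Ici 0] t]
          fun s => s - t := by
        apply IsLittleO.const_mul_left
        have e1 : (fun s => ‖N s - N t‖) =o[𝓝[Ici 0] t] fun _ => (1:ℝ) := by
          rw [isLittleO_one_iff]
          have : Tendsto (fun s => N s - N t) (𝓝[Ici 0] t) (𝓝 (N t - N t)) :=
            (hNc t ht).tendsto.sub_const _
          simpa using this.norm
        have e2 : (fun s => ‖u s - u t‖) =O[𝓝[Ici 0] t] fun s => s - t :=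
          ((h0 t ht).hasFDerivWithinAt.isBigO_sub).norm_left
        simpa using e1.mul_isBigO e2
      refine IsBigO.trans_isLittleO (IsBigO.of_bound 1 ?_) hb
      filter_upwards [self_mem_nhdsWithin] with s hs
      have c1 := hconv s hs t ht
      have c2 := hconv t ht s hs
      have c3 := real_inner_le_norm (N s - N t) (u s - u t)
      have c4 : 0 ≤ (2 * σ + 2) * (‖N s - N t‖ * ‖u s - u t‖) := by positivity
      have c5 : (2 * σ + 2) * inner ℝ (N s - N t) (u s - u t) ≤
        (2 * σ + 2) * (‖N s - N t‖ * ‖u s - u t‖) := by gcongr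
      rw [one_mul, Real.norm_of_nonneg c4, Real.norm_eq_abs, abs_le]
      simp only [inner_sub_left, inner_sub_right, smul_zero, sub_zero] at *
      constructor <;> linarith
    exact kg_dcongr (hrem.add hlin) (fun x => by simp) (by simp)
  have hQ : ∀ t ∈ Ici (0:ℝ), HasDerivWithinAt (fun s => inner ℝ (A (u s)) (u s))
      (2 * inner ℝ (A (u t)) (u' t)) (Ici 0) t := by
    intro t ht
    have hAu : HasDerivWithinAt (fun s => A (u s)) (A (u' t)) (Ici 0) t :=
      A.hasFDerivAt.comp_hasDerivWithinAt t (h0 t ht)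
    have := hAu.inner ℝ (h0 t ht)
    rw [hA (u' t), real_inner_comm (A (u t)) (u' t)] at this
    exact kg_dcongr this (fun x => rfl) (by ring)
  set e : ℝ → ℝ := fun t => ‖u' t‖ ^ 2 + inner ℝ (A (u t)) (u t)
    - inner ℝ (u t) (N t) / (σ + 1) with he
  have hder : ∀ t ∈ Ici (0:ℝ), HasDerivWithinAt e 0 (Ici 0) t := by
    intro t ht
    have := ((h1 t ht).norm_sq.add (hQ t ht)).sub ((hP t ht).div_const (σ + 1))
    refine kg_dcongr this (fun x => rfl) ?_
    rw [hN, inner_add_left, real_inner_comm (u' t) (u'' t)]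
    field_simp
    ring
  have hcons : ∀ t ∈ Ici (0:ℝ), e t = e 0 := by
    intro t ht
    refine constant_of_has_deriv_right_zero (a := 0) (b := t) (f := e) ?_ ?_ t ⟨ht, le_rfl⟩
    · intro s hs
      exact ((hder s hs.1).continuousWithinAt).mono Icc_subset_Ici_self
    · intro s hs
      exact (hder s hs.1).mono (Ici_subset_Ici.2 hs.1)
  have hy2 : ∀ t ∈ Ici (0:ℝ), 2 * (‖u' t‖ ^ 2 + inner ℝ (u t) (u'' t)) =
      (2 * σ + 4) * ‖u' t‖ ^ 2 + 2 * σ * inner ℝ (A (u t)) (u t) - 2 * (σ + 1) * e 0 := by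
    intro t ht
    rw [← hcons t ht, he]
    simp only [hN, inner_add_right]
    rw [real_inner_comm (A (u t)) (u t)]
    field_simp
    ring
  refine kg_ode (fun t => ‖u t‖ ^ 2) (fun t => 2 * inner ℝ (u t) (u' t))
    (fun t => 2 * (‖u' t‖ ^ 2 + inner ℝ (u t) (u'' t))) (- 2 * (σ + 1) * e 0) (σ / 2)
    (by have : e 0 < 0 := hE
        nlinarith) (by positivity) ?_ ?_ ?_ ?_ ?_
  · intro t ht
    exact (h0 t ht).norm_sq
  · intro t ht
    have := ((h0 t ht).inner ℝ (h1 t ht)).const_mul 2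
    refine kg_dcongr this (fun x => rfl) ?_
    rw [real_inner_self_eq_norm_sq]; ring
  · intro t ht; positivity
  · intro t ht
    rw [hy2 t ht]
    have a1 := hApos (u t)
    have : 0 ≤ (2 * σ + 4) * ‖u' t‖ ^ 2 + 2 * σ * inner ℝ (A (u t)) (u t) := by positivity
    linarith
  · intro t ht
    rw [hy2 t ht]
    have a1 := hApos (u t)
    have a2 : 0 ≤ 2 * σ * inner ℝ (A (u t)) (u t) - 2 * (σ + 1) * e 0 := by
      have : e 0 < 0 := hE
      have : 0 ≤ 2 * σ * inner ℝ (A (u t)) (u t) := by positivity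
      nlinarith
    have a3 : (inner ℝ (u t) (u' t)) ^ 2 ≤ ‖u t‖ ^ 2 * ‖u' t‖ ^ 2 := by
      rw [← mul_pow, sq_le_sq, abs_of_nonneg (a := ‖u t‖ * ‖u' t‖) (by positivity)]
      exact abs_real_inner_le_norm _ _
    have a4 := mul_nonneg (sq_nonneg ‖u t‖) a2
    nlinarith

lemma kg_convex (σ : ℝ) (hσ : 0 < σ) (a b : ℝ) :
    (2 * σ + 2) * (|a| ^ (2 * σ) * a * (b - a)) ≤
      b * (|b| ^ (2 * σ) * b) - a * (|a| ^ (2 * σ) * a) := by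
  have key : ∀ x : ℝ, x * (|x| ^ (2 * σ) * x) = |x| ^ (2 * σ + 2) := by
    intro x
    rw [Real.rpow_add_of_nonneg (abs_nonneg x) (by positivity) (by norm_num), Real.rpow_two,
      sq_abs]
    ring
  have hp : (0:ℝ) < 2 * σ + 2 := by positivity
  have hY := Real.geom_mean_le_arith_mean2_weighted (w₁ := (2 * σ + 1) / (2 * σ + 2))
    (w₂ := 1 / (2 * σ + 2)) (p₁ := |a| ^ (2 * σ + 2)) (p₂ := |b| ^ (2 * σ + 2))
    (by positivity) (by positivity) (by positivity) (by positivity) (by field_simp; ring)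
  rw [← Real.rpow_mul (abs_nonneg a), ← Real.rpow_mul (abs_nonneg b),
    mul_div_cancel₀ _ hp.ne', mul_div_cancel₀ _ hp.ne', Real.rpow_one] at hY
  have h3 : |a| ^ (2 * σ) * a * b ≤ |a| ^ (2 * σ + 1) * |b| := by
    rw [Real.rpow_add_of_nonneg (abs_nonneg a) (by positivity) (by norm_num), Real.rpow_one,
      mul_assoc, mul_assoc]
    have : a * b ≤ |a| * |b| := by rw [← abs_mul]; exact le_abs_self _
    gcongr
  have h4 : (2 * σ + 2) * ((2 * σ + 1) / (2 * σ + 2) * |a| ^ (2 * σ + 2)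
      + 1 / (2 * σ + 2) * |b| ^ (2 * σ + 2)) =
      (2 * σ + 1) * |a| ^ (2 * σ + 2) + |b| ^ (2 * σ + 2) := by
    field_simp
  have h5 := mul_le_mul_of_nonneg_left (h3.trans hY) hp.le
  rw [h4] at h5
  rw [key, key]
  have := key a
  nlinarith

abbrev L2 (d : ℕ) := lp (fun _ : ZLat d => ℝ) 2

lemma kg_memLp_iff {d : ℕ} (f : ZLat d → ℝ) :
    Memℓp (E := fun _ : ZLat d => ℝ) f 2 ↔ Summable fun n => f n ^ 2 := by
  rw [memℓp_gen_iff (by norm_num)]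
  simp

lemma kg_sq {d : ℕ} (f : L2 d) : Summable fun n => f n ^ 2 :=
  (kg_memLp_iff _).1 (lp.memℓp f)

/-- Shift on the lattice. -/
def kgShift {d : ℕ} (e : ZLat d ≃ ZLat d) : L2 d →ₗ[ℝ] L2 d where
  toFun f := ⟨fun n => f (e n), (kg_memLp_iff _).2 ((kg_sq f).comp_injective e.injective)⟩
  map_add' f g := by ext n; rfl
  map_smul' r f := by ext n; rfl

/-- Multiplication by the potential. -/
def kgMul {d : ℕ} (V : ZLat d → ℝ) (C : ℝ) (hV : ∀ n, |V n| ≤ C) : L2 d →ₗ[ℝ] L2 d where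
  toFun f := ⟨fun n => V n * f n, (kg_memLp_iff _).2 (by
    refine Summable.of_nonneg_of_le (fun n => sq_nonneg _) (fun n => ?_) ((kg_sq f).mul_left (C ^ 2))
    rw [mul_pow]
    have := sq_le_sq' (neg_le_of_abs_le (hV n)) (le_of_abs_le (hV n))
    gcongr)⟩
  map_add' f g := by ext n; exact mul_add _ _ _
  map_smul' r f := by ext n; exact mul_left_comm _ _ _

lemma kgShift_apply {d : ℕ} (e : ZLat d ≃ ZLat d) (f : L2 d) (n : ZLat d) :
    kgShift e f n = f (e n) := rfl

lemma kgMul_apply {d : ℕ} (V : ZLat d → ℝ) (C : ℝ) (hV : ∀ n, |V n| ≤ C) (f : L2 d)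
    (n : ZLat d) : kgMul V C hV f n = V n * f n := rfl

lemma kg_inner {d : ℕ} (f g : L2 d) : HasSum (fun n => f n * g n) (inner ℝ f g) := by
  have := lp.hasSum_inner (𝕜 := ℝ) f g
  exact kg_scongr this (fun n => by simp [mul_comm]) rfl

lemma kgShift_inner {d : ℕ} (e : ZLat d ≃ ZLat d) (f g : L2 d) :
    inner ℝ (kgShift e f) g = inner ℝ f (kgShift e.symm g) := by
  refine (kg_inner _ _).unique ?_
  have := e.hasSum_iff.2 (kg_inner f (kgShift e.symm g))
  simpa [Function.comp_def, kgShift_apply] using this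

lemma kgMul_inner {d : ℕ} (V : ZLat d → ℝ) (C : ℝ) (hV : ∀ n, |V n| ≤ C) (f g : L2 d) :
    inner ℝ (kgMul V C hV f) g = inner ℝ f (kgMul V C hV g) := by
  refine (kg_inner _ _).unique ?_
  convert kg_inner f (kgMul V C hV g) using 2 with n
  simp only [kgMul_apply]; ring

/-- The linear operator `-Δ_h + V`. -/
def kgOp {d : ℕ} (h : ℝ) (V : ZLat d → ℝ) (C : ℝ) (hV : ∀ n, |V n| ≤ C) : L2 d →ₗ[ℝ] L2 d :=
  kgMul V C hV + (1 / h ^ 2) • ∑ j : Fin d, ((2 : ℝ) • LinearMap.id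
    - kgShift (Equiv.addRight (latE j)) - kgShift (Equiv.addRight (latE j)).symm)

lemma kgOp_symm {d : ℕ} (h : ℝ) (V : ZLat d → ℝ) (C : ℝ) (hV : ∀ n, |V n| ≤ C) :
    (kgOp h V C hV).IsSymmetric := by
  intro f g
  simp only [kgOp, LinearMap.add_apply, LinearMap.smul_apply, LinearMap.sum_apply,
    LinearMap.sub_apply, LinearMap.id_apply, inner_add_left, inner_add_right, inner_smul_left,
    inner_smul_right, sum_inner, inner_sum, inner_sub_left, inner_sub_right, kgMul_inner,
    kgShift_inner, Equiv.symm_symm]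
  simp only [conj_trivial]
  congr 2
  refine Finset.sum_congr rfl fun j _ => ?_
  ring

lemma kgOp_apply {d : ℕ} (h : ℝ) (V : ZLat d → ℝ) (C : ℝ) (hV : ∀ n, |V n| ≤ C)
    (f : L2 d) (n : ZLat d) :
    kgOp h V C hV f n = V n * f n - discLapR d h f n := by
  simp only [kgOp, LinearMap.add_apply, LinearMap.smul_apply, LinearMap.sum_apply,
    LinearMap.sub_apply, LinearMap.id_apply, lp.coeFn_add, lp.coeFn_smul, lp.coeFn_sum,
    lp.coeFn_sub, Pi.add_apply, Pi.smul_apply, Pi.sub_apply, Finset.sum_apply, kgMul_apply,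
    kgShift_apply, discLapR, smul_eq_mul, Equiv.coe_addRight, Equiv.addRight_symm,
    ← sub_eq_add_neg]
  have : ∀ j : Fin d, 2 * f n - f (n + latE j) - f (n - latE j)
      = -(f (n + latE j) + f (n - latE j) - 2 * f n) := fun j => by ring
  simp only [this, Finset.sum_neg_distrib]
  ring

lemma kgOp_quad {d : ℕ} (h : ℝ) (V : ZLat d → ℝ) (C : ℝ) (hV : ∀ n, |V n| ≤ C) (f : L2 d) :
    HasSum (fun n => (∑ j : Fin d, (f (n + latE j) - f n) ^ 2) / h ^ 2 + V n * f n ^ 2)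
      (inner ℝ (kgOp h V C hV f) f) := by
  have h1 : ∀ j : Fin d, HasSum (fun n => (f (n + latE j) - f n) ^ 2)
      (inner ℝ (((2 : ℝ) • LinearMap.id - kgShift (Equiv.addRight (latE j))
        - kgShift (Equiv.addRight (latE j)).symm : L2 d →ₗ[ℝ] L2 d) f) f) := by
    intro j
    have := kg_inner (kgShift (Equiv.addRight (latE j)) f - f)
      (kgShift (Equiv.addRight (latE j)) f - f)
    refine kg_scongr this (fun n => ?_) ?_
    · simp only [lp.coeFn_sub, Pi.sub_apply, kgShift_apply, Equiv.coe_addRight]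
      ring
    · simp only [LinearMap.sub_apply, LinearMap.smul_apply, LinearMap.id_apply, inner_sub_left,
        inner_sub_right, inner_smul_left, conj_trivial]
      have e1 : inner ℝ (kgShift (Equiv.addRight (latE j)) f) (kgShift (Equiv.addRight (latE j)) f)
          = inner ℝ f f := by
        rw [kgShift_inner]
        congr 1
        ext n
        simp [kgShift_apply]
      have e2 : inner ℝ (kgShift (Equiv.addRight (latE j)).symm f) f
          = inner ℝ f (kgShift (Equiv.addRight (latE j)) f) := by
        rw [kgShift_inner, Equiv.symm_symm]
      rw [e1, e2]; ring
  have h2 := ((hasSum_sum fun j (_ : j ∈ Finset.univ) => h1 j).div_const (h ^ 2)).add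
    (kg_inner (kgMul V C hV f) f)
  refine kg_scongr h2 (fun n => ?_) ?_
  · rw [kgMul_apply]; ring
  · simp only [kgOp, LinearMap.add_apply, LinearMap.smul_apply, LinearMap.sum_apply,
      inner_add_left, inner_smul_left, sum_inner, conj_trivial]
    ring

end Helpers

/-- **Blow-up for the focusing discrete nonlinear Klein–Gordon equation with negative energy.**
If `λ = −1`, `inf_n V_n > 0`, `V` is bounded and the real-valued datum `(f,g) ∈ l²_h × l²_h` has
negative energy `E(f,g) < 0`, then there is no global (twice continuously differentiable)
solution on `[0,∞)` with `u(0) = f`, `∂_t u(0) = g`: the maximal time of existence is finite. -/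
theorem dkg_focusing_blowup
    (d : ℕ) (hd : 1 ≤ d) (h : ℝ) (hh : 0 < h) (σ : ℝ) (hσ : 0 < σ)
    (V : ZLat d → ℝ) (CV : ℝ) (hVbdd : ∀ n, |V n| ≤ CV)
    (c : ℝ) (hc : 0 < c) (hVlow : ∀ n, c ≤ V n)
    (f g : lp (fun _ : ZLat d => ℝ) 2)
    (hE : energyKG d h σ (-1) V (⇑f) (⇑g) < 0) :
    ¬ ∃ u u' u'' : ℝ → lp (fun _ : ZLat d => ℝ) 2,
        IsDKGSolutionOn d h σ (-1) V 2 (Set.Ici 0) u u' u'' ∧ u 0 = f ∧ u' 0 = g := by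
  rintro ⟨u, u', u'', ⟨h0, h1, h2, heq⟩, rfl, rfl⟩
  have hsym := kgOp_symm h V CV hVbdd
  let A : L2 d →L[ℝ] L2 d := ⟨kgOp h V CV hVbdd, hsym.continuous⟩
  have hAdef : ∀ f, A f = kgOp h V CV hVbdd f := fun f => rfl
  have hN : ∀ t ∈ Set.Ici (0:ℝ), ∀ n, (u'' t + A (u t)) n = |u t n| ^ (2 * σ) * u t n := by
    intro t ht n
    have := heq t ht n
    rw [lp.coeFn_add, Pi.add_apply, hAdef, kgOp_apply]
    linarith
  refine kg_abstract A hsym (fun f => ?_) σ hσ u u' u'' (fun t => u'' t + A (u t)) h0 h1 h2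
    (fun t => rfl) ?_ ?_
  · refine (kgOp_quad h V CV hVbdd f).nonneg fun n => ?_
    have := hc.le.trans (hVlow n)
    positivity
  · intro s hs t ht
    refine hasSum_le (fun n => ?_) ((kg_inner (u'' t + A (u t)) (u s - u t)).mul_left (2 * σ + 2))
      ((kg_inner (u s) (u'' s + A (u s))).sub (kg_inner (u t) (u'' t + A (u t))))
    rw [hN t ht, hN s hs]
    exact kg_convex σ hσ (u t n) (u s n)
  · have z : (0:ℝ) ∈ Set.Ici (0:ℝ) := Set.mem_Ici.2 le_rfl
    have hs := ((kg_inner (u' 0) (u' 0)).add (kgOp_quad h V CV hVbdd (u 0))).sub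
      ((kg_inner (u 0) (u'' 0 + A (u 0))).div_const (σ + 1))
    rw [real_inner_self_eq_norm_sq] at hs
    have hs' : HasSum (fun n : ZLat d => u' 0 n ^ 2
        + (∑ j : Fin d, (u 0 (n + latE j) - u 0 n) ^ 2) / h ^ 2 + V n * u 0 n ^ 2
        + ((-1) / (σ + 1)) * |u 0 n| ^ (2 * σ + 2)) (‖u' 0‖ ^ 2 + inner ℝ (kgOp h V CV hVbdd (u 0)) (u 0)
          - inner ℝ (u 0) (u'' 0 + A (u 0)) / (σ + 1)) := by
      refine kg_scongr hs (fun n => ?_) rfl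
      rw [hN 0 z, Real.rpow_add_of_nonneg (abs_nonneg _) (by positivity) (by norm_num),
        Real.rpow_two, sq_abs]
      ring
    unfold energyKG at hE
    rw [hs'.tsum_eq] at hE
    simp only [hAdef] at hE ⊢
    linarith
end
end

section
/- l² control of solutions of the defocusing discrete nonlinear Klein–Gordon equation: Let d ≥ 1, 0 < h ≤ 1, σ > 0, λ = 1, and let V = {V_n} ∈ l^∞_h be a bounded real-valued potential with δ := inf_{n∈hℤ^d} (V_n + 2d h^{-2}) > 0. Let (f,g) ∈ l²_h × l²_h be real-valued and let u : I → l²_h be a twice continuously differentiable solution of ∂_t² u_n − (Δ_h u)_n + V_n u_n + |u_n|^{2σ} u_n = 0 with u(0) = f, ∂_t u(0) = g, on an interval I ∋ 0. Then there exists a constant C > 0, depending only on d, σ, δ and ‖V‖_{l^∞_h}, such that for all t ∈ I, ‖(u(t), ∂_t u(t))‖_{l²_h × l²_h} ≤ C e^{C h^{-2} |t|} ( ‖(f,g)‖_{l²_h × l²_h} + ‖f‖_{l²_h}^{σ+1} ). -/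
noncomputable section

open scoped ENNReal

/-- Abstract Gronwall lemma for a family of partial energies. -/
lemma aux_gronwall {ι : Type*} (m : ℝ → ℝ) (φ φ' : ι → ℝ → ℝ) (κ F0 : ℝ) (hκ : 0 ≤ κ)
    (hF0 : 0 ≤ F0) (hm : ContinuousOn m (Set.Icc 0 1)) (hm0 : ∀ s, 0 ≤ m s)
    (hφ : ∀ A, ∀ s ∈ Set.Icc (0 : ℝ) 1, HasDerivWithinAt (φ A) (φ' A s) (Set.Icc 0 1) s)
    (hb : ∀ A, ∀ s ∈ Set.Icc (0 : ℝ) 1, φ' A s ≤ κ * m s)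
    (h0 : ∀ A, φ A 0 ≤ F0)
    (hsup : ∀ s ∈ Set.Icc (0 : ℝ) 1, ∀ c, (∀ A, φ A s ≤ c) → m s ≤ c) :
    m 1 ≤ F0 * Real.exp κ := by
  set M : ℝ → ℝ := Set.IccExtend (zero_le_one (α := ℝ)) ((Set.Icc (0 : ℝ) 1).domRestrict m) with hM
  have hMc : Continuous M := by
    apply Continuous.Icc_extend'
    exact continuousOn_iff_continuous_domRestrict.1 hm
  have hMm : ∀ s ∈ Set.Icc (0 : ℝ) 1, M s = m s := by
    intro s hs
    rw [hM, Set.IccExtend_of_mem _ _ hs]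
    rfl
  have hM0 : ∀ s, 0 ≤ M s := fun s => hm0 _
  let b : ℝ → ℝ := fun s => F0 + ∫ r in (0 : ℝ)..s, κ * M r
  have hbd : ∀ s, HasDerivAt b (κ * M s) s := by
    intro s
    have hc : Continuous (fun r => κ * M r) := by fun_prop
    exact (intervalIntegral.integral_hasDerivAt_right (hc.intervalIntegrable _ _)
      (hc.stronglyMeasurableAtFilter _ _) hc.continuousAt).const_add F0
  have hbc : Continuous b := continuous_iff_continuousAt.2 fun s => (hbd s).continuousAt
  have hb00 : b 0 = F0 := by simp [b]
  have hle : ∀ A, ∀ s ∈ Set.Icc (0 : ℝ) 1, φ A s ≤ b s := by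
    intro A s hs
    refine image_le_of_deriv_right_le_deriv_boundary (f := φ A) (f' := φ' A) (a := 0) (b := 1)
      (B := b) (B' := fun s => κ * M s) (fun x hx => (hφ A x hx).continuousWithinAt)
      ?_ (by rw [hb00]; exact h0 A) hbc.continuousOn (fun x _ => (hbd x).hasDerivWithinAt) ?_ hs
    · intro x hx
      exact (hφ A x (Set.Ico_subset_Icc_self hx)).mono_of_mem_nhdsWithin
        (Icc_mem_nhdsGE_of_mem hx)
    · intro x hx
      have hx' := Set.Ico_subset_Icc_self hx
      show φ' A x ≤ κ * M x
      rw [hMm x hx']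
      exact hb A x hx'
  have hmb : ∀ s ∈ Set.Icc (0 : ℝ) 1, m s ≤ b s := fun s hs =>
    hsup s hs _ fun A => hle A s hs
  have hb1 : ‖b 1‖ ≤ gronwallBound F0 κ 0 (1 - 0) := by
    refine norm_le_gronwallBound_of_norm_deriv_right_le (f := b) (f' := fun s => κ * M s)
      (a := 0) (b := 1) hbc.continuousOn (fun x _ => (hbd x).hasDerivWithinAt) ?_ ?_ 1 (by simp)
    · rw [hb00, Real.norm_of_nonneg hF0]
    · intro x hx
      have hx' := Set.Ico_subset_Icc_self hx
      rw [Real.norm_of_nonneg (mul_nonneg hκ (hM0 x)), hMm x hx', add_zero]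
      exact mul_le_mul_of_nonneg_left ((hmb x hx').trans (le_abs_self _)) hκ
  rw [gronwallBound_ε0] at hb1
  calc m 1 ≤ b 1 := hmb 1 (by simp)
    _ ≤ ‖b 1‖ := le_abs_self _
    _ ≤ _ := by simpa using hb1

lemma aux_hasSum {d : ℕ} (x : lp (fun _ : ZLat d => ℝ) 2) :
    HasSum (fun n => (x : ZLat d → ℝ) n ^ 2) (‖x‖ ^ 2) := by
  have := lp.hasSum_inner (𝕜 := ℝ) x x
  rw [real_inner_self_eq_norm_sq] at this
  simpa [pow_two] using this

lemma aux_sum_le {d : ℕ} (x : lp (fun _ : ZLat d => ℝ) 2) (A : Finset (ZLat d))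
    (e : ZLat d → ZLat d) (he : Function.Injective e) :
    ∑ n ∈ A, (x : ZLat d → ℝ) (e n) ^ 2 ≤ ‖x‖ ^ 2 := by
  classical
  have h1 : ∑ n ∈ A, (x : ZLat d → ℝ) (e n) ^ 2
      = ∑ n ∈ A.image e, (x : ZLat d → ℝ) n ^ 2 :=
    (Finset.sum_image (f := fun n => (x : ZLat d → ℝ) n ^ 2) (he.injOn)).symm
  rw [h1]
  exact sum_le_hasSum _ (fun _ _ => sq_nonneg _) (aux_hasSum x)

/-- Coordinate evaluation is differentiable. -/
lemma aux_coord {d : ℕ} {S : Set ℝ} {u : ℝ → lp (fun _ : ZLat d => ℝ) 2}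
    {v : lp (fun _ : ZLat d => ℝ) 2} {t : ℝ}
    (h : HasDerivWithinAt u v S t) (n : ZLat d) :
    HasDerivWithinAt (fun s => (u s : ZLat d → ℝ) n) ((v : ZLat d → ℝ) n) S t := by
  have := (lp.evalCLM ℝ (fun _ : ZLat d => ℝ) 2 n).hasFDerivAt.comp_hasDerivWithinAt t h
  exact this

lemma aux_flux {d : ℕ} {h CV : ℝ} (hh : 0 < h) (h1 : h ≤ 1) {V : ZLat d → ℝ}
    (hV : ∀ n, |V n| ≤ CV) (x y : lp (fun _ : ZLat d => ℝ) 2) (A : Finset (ZLat d)) :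
    |∑ n ∈ A, (y : ZLat d → ℝ) n * ((x : ZLat d → ℝ) n + discLapR d h x n
        - V n * (x : ZLat d → ℝ) n)|
      ≤ (1 + |CV| + 4 * d) / h ^ 2 * ((‖x‖ ^ 2 + ‖y‖ ^ 2) / 2) := by
  have hx0 := aux_sum_le x A id Function.injective_id
  have hy0 := aux_sum_le y A id Function.injective_id
  simp only [id] at hx0 hy0
  have hp : ∀ n, |(y : ZLat d → ℝ) n * ((x : ZLat d → ℝ) n + discLapR d h x n
        - V n * (x : ZLat d → ℝ) n)| ≤
      (1 + |CV|) * ((x : ZLat d → ℝ) n ^ 2 + (y : ZLat d → ℝ) n ^ 2) / 2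
      + (∑ j : Fin d, (2 * (y : ZLat d → ℝ) n ^ 2 + (x : ZLat d → ℝ) (n + latE j) ^ 2 / 2
        + (x : ZLat d → ℝ) (n - latE j) ^ 2 / 2 + (x : ZLat d → ℝ) n ^ 2)) / h ^ 2 := by
    intro n
    set a := (x : ZLat d → ℝ) n
    set c := (y : ZLat d → ℝ) n
    have e : c * (a + discLapR d h x n - V n * a) = c * a * (1 - V n)
        + (∑ j : Fin d, c * ((x : ZLat d → ℝ) (n + latE j) + (x : ZLat d → ℝ) (n - latE j)
          - 2 * a)) / h ^ 2 := by
      rw [← Finset.mul_sum]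
      unfold discLapR
      ring
    rw [e]
    refine (abs_add_le _ _).trans (add_le_add ?_ ?_)
    · rw [abs_mul]
      have i1 : |c * a| ≤ (a ^ 2 + c ^ 2) / 2 := by
        rw [abs_le]
        constructor <;> nlinarith [sq_nonneg (a + c), sq_nonneg (a - c)]
      have i2 : |1 - V n| ≤ 1 + |CV| := by
        refine (abs_sub _ _).trans ?_
        have := (hV n).trans (le_abs_self CV)
        simpa using this
      calc |c * a| * |1 - V n| ≤ (a ^ 2 + c ^ 2) / 2 * (1 + |CV|) := by gcongr
        _ = _ := by ring
    · rw [abs_div, abs_of_pos (show 0 < h ^ 2 by positivity)]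
      gcongr
      refine (Finset.abs_sum_le_sum_abs _ _).trans (Finset.sum_le_sum fun j _ => ?_)
      set p := (x : ZLat d → ℝ) (n + latE j)
      set q := (x : ZLat d → ℝ) (n - latE j)
      rw [abs_le]
      constructor
      · nlinarith [sq_nonneg (c + p), sq_nonneg (c + q), sq_nonneg (c - a)]
      · nlinarith [sq_nonneg (c - p), sq_nonneg (c - q), sq_nonneg (c + a)]
  refine (Finset.abs_sum_le_sum_abs _ _).trans ((Finset.sum_le_sum fun n _ => hp n).trans ?_)
  rw [Finset.sum_add_distrib, ← Finset.sum_div, ← Finset.sum_div, ← Finset.mul_sum,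
    Finset.sum_comm, Finset.sum_add_distrib]
  have hj : ∀ j : Fin d, ∑ n ∈ A, (2 * (y : ZLat d → ℝ) n ^ 2
        + (x : ZLat d → ℝ) (n + latE j) ^ 2 / 2
        + (x : ZLat d → ℝ) (n - latE j) ^ 2 / 2 + (x : ZLat d → ℝ) n ^ 2)
        ≤ 2 * (‖x‖ ^ 2 + ‖y‖ ^ 2) := by
    intro j
    have k1 := aux_sum_le x A (fun n => n + latE j) (add_left_injective _)
    have k2 := aux_sum_le x A (fun n => n - latE j) (sub_left_injective)
    simp only [Finset.sum_add_distrib, ← Finset.sum_div, ← Finset.mul_sum]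
    linarith
  have hs := Finset.sum_le_sum fun j (_ : j ∈ Finset.univ) => hj j
  rw [Finset.sum_const, Finset.card_univ, Fintype.card_fin, nsmul_eq_mul] at hs
  have hh2 : 0 < h ^ 2 := by positivity
  have hh3 : h ^ 2 ≤ 1 := by nlinarith
  set N := ‖x‖ ^ 2 + ‖y‖ ^ 2
  have hN : 0 ≤ N := by positivity
  have hc : 0 ≤ (1 + |CV|) * N / 2 := by positivity
  have t1 : (1 + |CV|) * (∑ n ∈ A, (x : ZLat d → ℝ) n ^ 2 + ∑ n ∈ A, (y : ZLat d → ℝ) n ^ 2) / 2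
      ≤ (1 + |CV|) * N / 2 / h ^ 2 := by
    refine le_trans ?_ (le_div_self hc hh2 hh3)
    gcongr
    exact add_le_add hx0 hy0
  calc _ ≤ (1 + |CV|) * N / 2 / h ^ 2 + (d * (2 * N)) / h ^ 2 := by
        refine add_le_add t1 ?_
        gcongr
    _ = _ := by ring

lemma aux_init {d : ℕ} {σ : ℝ} (hσ : 0 < σ) (f : lp (fun _ : ZLat d => ℝ) 2)
    (A : Finset (ZLat d)) :
    ∑ n ∈ A, |(f : ZLat d → ℝ) n| ^ (2 * σ + 2) ≤ (‖f‖ ^ (σ + 1)) ^ 2 := by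
  have e : ∀ r : ℝ, 0 ≤ r → r ^ (2 * σ + 2) = r ^ (2 * σ) * r ^ 2 := by
    intro r hr
    rw [Real.rpow_add_of_nonneg hr (by positivity) (by norm_num)]
    norm_num
  have e2 : (‖f‖ ^ (σ + 1)) ^ 2 = ‖f‖ ^ (2 * σ) * ‖f‖ ^ 2 := by
    rw [← e _ (norm_nonneg _), ← Real.rpow_natCast, ← Real.rpow_mul (norm_nonneg _)]
    congr 1
    push_cast
    ring
  rw [e2]
  calc _ ≤ ∑ n ∈ A, ‖f‖ ^ (2 * σ) * (f : ZLat d → ℝ) n ^ 2 := by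
        refine Finset.sum_le_sum fun n _ => ?_
        rw [e _ (abs_nonneg _), sq_abs]
        gcongr
        exact lp.norm_apply_le_norm (by norm_num) f n
    _ ≤ _ := by
        rw [← Finset.mul_sum]
        gcongr
        exact aux_sum_le f A id Function.injective_id

/-- **`l²` control of solutions of the defocusing discrete nonlinear Klein–Gordon equation.**
If `λ = 1`, `V` is bounded (by `CV`) and `V_n + 2d h⁻² ≥ δ > 0` for all `n`, then there is a
constant `C > 0`, depending only on `d`, `σ`, `δ` and `CV`, such that every twice continuously
differentiable solution on an interval `S ∋ 0` with real-valued data `(f,g) ∈ l²_h × l²_h`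
satisfies `‖(u(t),∂_t u(t))‖ ≤ C e^{C h⁻² |t|} (‖(f,g)‖ + ‖f‖^{σ+1})`. -/
theorem dkg_l2_control
    (d : ℕ) (hd : 1 ≤ d) (σ : ℝ) (hσ : 0 < σ) (δ CV : ℝ) (hδ : 0 < δ) :
    ∃ C : ℝ, 0 < C ∧
      ∀ (h : ℝ), 0 < h → h ≤ 1 →
      ∀ (V : ZLat d → ℝ), (∀ n, |V n| ≤ CV) → (∀ n, δ ≤ V n + 2 * d / h ^ 2) →
      ∀ (S : Set ℝ), Convex ℝ S → (0 : ℝ) ∈ S →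
      ∀ (f g : lp (fun _ : ZLat d => ℝ) 2) (u u' u'' : ℝ → lp (fun _ : ZLat d => ℝ) 2),
        IsDKGSolutionOn d h σ 1 V 2 S u u' u'' → u 0 = f → u' 0 = g →
        ∀ t ∈ S, ‖u t‖ + ‖u' t‖
          ≤ C * Real.exp (C * |t| / h ^ 2) * (‖f‖ + ‖g‖ + ‖f‖ ^ (σ + 1)) := by
  refine ⟨1 + |CV| + 4 * d + 2, by positivity, ?_⟩
  intro h hh h1 V hV _ S hS hS0 f g u u' u'' hu hf hg t ht
  obtain ⟨hu1, hu2, -, heq⟩ := hu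
  have hmem : ∀ s ∈ Set.Icc (0 : ℝ) 1, s * t ∈ S := by
    intro s hs
    have := hS hS0 ht (sub_nonneg.2 hs.2) hs.1 (by ring)
    simpa using this
  set K : ℝ := 1 + |CV| + 4 * d with hK
  have hK0 : 0 ≤ K := by positivity
  have hsc : ∀ s ∈ Set.Icc (0 : ℝ) 1,
      HasDerivWithinAt (fun s : ℝ => s * t) t (Set.Icc 0 1) s := by
    intro s _
    simpa using ((hasDerivAt_id s).mul_const t).hasDerivWithinAt
  have hd1 : ∀ s ∈ Set.Icc (0 : ℝ) 1, HasDerivWithinAt (fun s => u (s * t)) (t • u' (s * t))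
      (Set.Icc 0 1) s := fun s hs =>
    HasDerivWithinAt.scomp s (hu1 _ (hmem s hs)) (hsc s hs) hmem
  have hd2 : ∀ s ∈ Set.Icc (0 : ℝ) 1, HasDerivWithinAt (fun s => u' (s * t)) (t • u'' (s * t))
      (Set.Icc 0 1) s := fun s hs =>
    HasDerivWithinAt.scomp s (hu2 _ (hmem s hs)) (hsc s hs) hmem
  have hc1 : ContinuousOn (fun s => u (s * t)) (Set.Icc 0 1) :=
    fun s hs => (hd1 s hs).continuousWithinAt
  have hc2 : ContinuousOn (fun s => u' (s * t)) (Set.Icc 0 1) :=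
    fun s hs => (hd2 s hs).continuousWithinAt
  set R : ℝ := ‖f‖ + ‖g‖ + ‖f‖ ^ (σ + 1) with hR
  have hfp : 0 ≤ ‖f‖ ^ (σ + 1) := Real.rpow_nonneg (norm_nonneg _) _
  have hR0 : 0 ≤ R := by positivity
  have key := aux_gronwall (ι := Finset (ZLat d))
    (fun s => (‖u (s * t)‖ ^ 2 + ‖u' (s * t)‖ ^ 2) / 2)
    (fun A s => ∑ n ∈ A, ((u' (s * t) : ZLat d → ℝ) n ^ 2 + (u (s * t) : ZLat d → ℝ) n ^ 2
      + |(u (s * t) : ZLat d → ℝ) n| ^ (2 * σ + 2) / (σ + 1)) / 2)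
    (fun A s => t * ∑ n ∈ A, (u' (s * t) : ZLat d → ℝ) n * ((u (s * t) : ZLat d → ℝ) n
      + discLapR d h (u (s * t)) n - V n * (u (s * t) : ZLat d → ℝ) n))
    (|t| * (K / h ^ 2)) (R ^ 2 / 2) (by positivity) (by positivity)
    (((hc1.norm.pow 2).add (hc2.norm.pow 2)).div_const 2) (fun s => by positivity)
    ?_ ?_ ?_ ?_
  · simp only [one_mul] at key
    have hE : 1 ≤ Real.exp (|t| * (K / h ^ 2)) := Real.one_le_exp (by positivity)
    have hsq : (‖u t‖ + ‖u' t‖) ^ 2 ≤ (2 * Real.exp (|t| * (K / h ^ 2)) * R) ^ 2 := by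
      set E := Real.exp (|t| * (K / h ^ 2))
      have : E * R ^ 2 ≤ E ^ 2 * R ^ 2 := by
        gcongr
        nlinarith
      nlinarith [sq_nonneg (‖u t‖ - ‖u' t‖), mul_nonneg (zero_le_one.trans hE) (sq_nonneg R)]
    have hle := abs_le_of_sq_le_sq hsq (by positivity)
    refine (le_abs_self _).trans (hle.trans ?_)
    have hex : |t| * (K / h ^ 2) ≤ (K + 2) * |t| / h ^ 2 := by
      rw [← mul_div_assoc, mul_comm |t| K]
      gcongr
      linarith
    gcongr
    linarith
  · intro A s hs
    rw [Finset.mul_sum]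
    refine HasDerivWithinAt.fun_sum fun n _ => ?_
    have a1 := aux_coord (hd1 s hs) n
    have a2 := aux_coord (hd2 s hs) n
    have a3 := (hasDerivAt_abs_rpow ((u (s * t) : ZLat d → ℝ) n)
      (show 1 < 2 * σ + 2 by linarith)).comp_hasDerivWithinAt s a1
    have a4 := (((a2.fun_pow 2).fun_add (a1.fun_pow 2)).fun_add (a3.div_const (σ + 1))).div_const 2
    refine a4.congr_deriv ?_
    have he := heq (s * t) (hmem s hs) n
    have hs1 : σ + 1 ≠ 0 := by positivity
    simp only [lp.coeFn_smul, Pi.smul_apply, smul_eq_mul]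
    rw [show 2 * σ + 2 - 2 = 2 * σ by ring]
    have he' : (u'' (s * t) : ZLat d → ℝ) n = discLapR d h (u (s * t)) n
      - V n * (u (s * t) : ZLat d → ℝ) n
      - |(u (s * t) : ZLat d → ℝ) n| ^ (2 * σ) * (u (s * t) : ZLat d → ℝ) n := by linarith
    rw [he']
    field_simp
    ring
  · intro A s hs
    refine (le_abs_self _).trans ?_
    rw [abs_mul, mul_assoc]
    exact mul_le_mul_of_nonneg_left (aux_flux hh h1 hV _ _ A) (abs_nonneg t)
  · intro A
    simp only [zero_mul, hf, hg]
    rw [← Finset.sum_div, Finset.sum_add_distrib, Finset.sum_add_distrib, ← Finset.sum_div]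
    have i1 := aux_sum_le f A id Function.injective_id
    have i2 := aux_sum_le g A id Function.injective_id
    have i3 := aux_init hσ f A
    simp only [id] at i1 i2
    have i4 : (∑ n ∈ A, |(f : ZLat d → ℝ) n| ^ (2 * σ + 2)) / (σ + 1)
        ≤ ∑ n ∈ A, |(f : ZLat d → ℝ) n| ^ (2 * σ + 2) :=
      div_le_self (Finset.sum_nonneg fun n _ => Real.rpow_nonneg (abs_nonneg _) _) (by linarith)
    have i5 : ‖g‖ ^ 2 + ‖f‖ ^ 2 + (‖f‖ ^ (σ + 1)) ^ 2 ≤ R ^ 2 := by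
      rw [hR]
      nlinarith [mul_nonneg (norm_nonneg f) (norm_nonneg g), mul_nonneg (norm_nonneg f) hfp,
        mul_nonneg (norm_nonneg g) hfp]
    linarith
  · intro s hs c hc
    have H := ((aux_hasSum (u (s * t))).add (aux_hasSum (u' (s * t)))).div_const 2
    refine hasSum_le_of_sum_le H fun A => le_trans (Finset.sum_le_sum fun n _ => ?_) (hc A)
    have : 0 ≤ |(u (s * t) : ZLat d → ℝ) n| ^ (2 * σ + 2) / (σ + 1) := by positivity
    linarith
end
end
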